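/- In Bareiss fraction-free elimination, the pivot entries are the leading principal minors: let F be a field and A an n×n matrix over F whose leading principal minors p_1(A),…,p_{n−1}(A) are all nonzero, and define the tableaux α^{(k)} by α^{(1)}_{i,j} = A_{i,j} and α^{(k+1)}_{i,j} = (α^{(k)}_{k,k} · α^{(k)}_{i,j} − α^{(k)}_{i,k} · α^{(k)}_{k,j}) / α^{(k−1)}_{k−1,k−1} for i, j > k (divisor 1 when k = 1). Then α^{(k)}_{k,k} = p_k(A) for every 1 ≤ k ≤ n; in particular α^{(n)}_{n,n} = det A. -/

import Mathlib

/-- The leading principal minor of order `k` of an `n × n` matrix `A`. -/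
def pminor {R : Type*} [CommRing R] {n : ℕ} (A : Matrix (Fin n) (Fin n) R)
    (k : ℕ) (h : k ≤ n) : R :=
  (A.submatrix (Fin.castLE h) (Fin.castLE h)).det

/-- The minor of `A` obtained by bordering the leading principal submatrix of order `k` with the
rows `r` and the columns `c`. -/
def borderedMinor {R : Type*} [CommRing R] {n m : ℕ} (A : Matrix (Fin n) (Fin n) R)
    (k : ℕ) (h : k ≤ n) (r c : Fin m → Fin n) : R :=
  (A.submatrix (Fin.append (Fin.castLE h) r) (Fin.append (Fin.castLE h) c)).det

/-- The Schur complement formula for bordered minors. -/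
theorem exists_borderedMinor_eq_pminor_mul_det {R : Type*} [CommRing R] {n k : ℕ}
    (A : Matrix (Fin n) (Fin n) R) (h : k ≤ n) (hu : IsUnit (pminor A k h)) :
    ∃ S : Matrix (Fin n) (Fin n) R, ∀ {m : ℕ} (r c : Fin m → Fin n),
      borderedMinor A k h r c = pminor A k h * (S.submatrix r c).det := by
  let P := A.submatrix (Fin.castLE h) (Fin.castLE h)
  have := P.invertibleOfIsUnitDet hu
  refine ⟨A - A.submatrix id (Fin.castLE h) * ⅟P * A.submatrix (Fin.castLE h) id, fun {m} r c => ?_⟩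
  rw [borderedMinor, ← Matrix.det_submatrix_equiv_self finSumFinEquiv]
  have hb : ((A.submatrix (Fin.append (Fin.castLE h) r) (Fin.append (Fin.castLE h) c)).submatrix
      finSumFinEquiv finSumFinEquiv) = Matrix.fromBlocks P (A.submatrix (Fin.castLE h) c)
        (A.submatrix r (Fin.castLE h)) (A.submatrix r c) := by
    ext (i | i) (j | j) <;> simp [P]
  rw [hb, Matrix.det_fromBlocks₁₁]
  rfl

/-- Moving the last row and column of the leading block into the border. -/
theorem borderedMinor_succ {R : Type*} [CommRing R] {n m k : ℕ} (A : Matrix (Fin n) (Fin n) R)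
    (h : k + 1 ≤ n) (r c : Fin m → Fin n) :
    borderedMinor A (k + 1) h r c =
      borderedMinor A k (Nat.le_of_succ_le h) (Fin.cons ⟨k, h⟩ r : Fin (m + 1) → Fin n)
        (Fin.cons ⟨k, h⟩ c : Fin (m + 1) → Fin n) := by
  have hs : Fin.castLE h = (Fin.snoc (Fin.castLE (Nat.le_of_succ_le h)) ⟨k, h⟩ :
      Fin (k + 1) → Fin n) := by
    ext x
    refine Fin.lastCases ?_ (fun x => ?_) x <;> simp
  rw [borderedMinor, borderedMinor, hs, Fin.append_left_snoc, Fin.append_left_snoc,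
    ← Matrix.det_submatrix_equiv_self (finCongr (Nat.succ_add_eq_add_succ k m)) (A.submatrix _ _)]
  rfl

theorem borderedMinor_elim0 {R : Type*} [CommRing R] {n k : ℕ} (A : Matrix (Fin n) (Fin n) R)
    (h : k ≤ n) (r c : Fin 0 → Fin n) : borderedMinor A k h r c = pminor A k h := by
  rw [borderedMinor, Fin.append_right_nil _ _ rfl, Fin.append_right_nil _ _ rfl]
  rfl

theorem pminor_succ {R : Type*} [CommRing R] {n k : ℕ} (A : Matrix (Fin n) (Fin n) R)
    (h : k + 1 ≤ n) :
    pminor A (k + 1) h = borderedMinor A k (Nat.le_of_succ_le h) ![⟨k, h⟩] ![⟨k, h⟩] := by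
  rw [← borderedMinor_elim0 A h ![] ![], borderedMinor_succ]
  rfl

theorem borderedMinor_zero {R : Type*} [CommRing R] {n : ℕ} (A : Matrix (Fin n) (Fin n) R)
    (h : 0 ≤ n) (i j : Fin n) : borderedMinor A 0 h ![i] ![j] = A i j := by
  rw [borderedMinor, Fin.append_left_nil _ _ rfl, Fin.append_left_nil _ _ rfl]
  exact (Matrix.det_fin_one _).trans rfl

/-- The Sylvester identity for `2 × 2` minors, when the leading principal minor is a unit. -/
theorem pminor_mul_borderedMinor_succ {R : Type*} [CommRing R] {n k : ℕ}
    (A : Matrix (Fin n) (Fin n) R) (h : k + 1 ≤ n)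
    (hu : IsUnit (pminor A k (Nat.le_of_succ_le h))) (i j : Fin n) :
    pminor A k (Nat.le_of_succ_le h) * borderedMinor A (k + 1) h ![i] ![j] =
      borderedMinor A k (Nat.le_of_succ_le h) ![⟨k, h⟩] ![⟨k, h⟩] *
          borderedMinor A k (Nat.le_of_succ_le h) ![i] ![j] -
        borderedMinor A k (Nat.le_of_succ_le h) ![i] ![⟨k, h⟩] *
          borderedMinor A k (Nat.le_of_succ_le h) ![⟨k, h⟩] ![j] := by
  obtain ⟨S, hS⟩ := exists_borderedMinor_eq_pminor_mul_det A (Nat.le_of_succ_le h) hu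
  rw [borderedMinor_succ]
  change _ * borderedMinor (m := 2) A k _ ![⟨k, h⟩, i] ![⟨k, h⟩, j] = _
  simp only [hS, Matrix.det_fin_one, Matrix.det_fin_two, Matrix.submatrix_apply,
    Matrix.cons_val_zero, Matrix.cons_val_one]
  ring

/-- In Bareiss fraction-free elimination, the pivot entries are the leading
principal minors: `α^{(k)}_{k,k} = p_k(A)` for `1 ≤ k ≤ n` (1-indexed, so the
1-indexed entry `(k,k)` is the 0-indexed `(k-1,k-1)`); in particular
`α^{(n)}_{n,n} = det A`. -/
theorem stmt4 {F : Type*} [Field F] {n : ℕ} (A : Matrix (Fin n) (Fin n) F)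
    (hp : ∀ k (_ : 1 ≤ k) (_ : k ≤ n - 1), pminor A k (by omega) ≠ 0)
    (α : ℕ → Fin n → Fin n → F)
    (hinit : ∀ i j, α 1 i j = A i j)
    (hrec : ∀ k (hk1 : 1 ≤ k) (hk : k ≤ n - 1), ∀ i j : Fin n,
      k ≤ (i : ℕ) → k ≤ (j : ℕ) →
      α (k + 1) i j =
        (α k ⟨k - 1, by omega⟩ ⟨k - 1, by omega⟩ * α k i j -
            α k i ⟨k - 1, by omega⟩ * α k ⟨k - 1, by omega⟩ j) /
          (if k = 1 then 1 else α (k - 1) ⟨k - 2, by omega⟩ ⟨k - 2, by omega⟩)) :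
    (∀ k (hk1 : 1 ≤ k) (hk : k ≤ n),
      α k ⟨k - 1, by omega⟩ ⟨k - 1, by omega⟩ = pminor A k hk) ∧
    (∀ hn : 1 ≤ n, α n ⟨n - 1, by omega⟩ ⟨n - 1, by omega⟩ = A.det) := by
  have key : ∀ k (hk : k + 1 ≤ n) (i j : Fin n), k ≤ (i : ℕ) → k ≤ (j : ℕ) →
      α (k + 1) i j = borderedMinor A k (Nat.le_of_succ_le hk) ![i] ![j] := by
    intro k
    induction k using Nat.strong_induction_on with | _ k ih
    cases k with
    | zero =>
      intro hk i j _ _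
      rw [borderedMinor_zero, hinit]
    | succ k =>
      intro hk i j hi hj
      have hk' : k + 1 ≤ n := Nat.le_of_succ_le hk
      have hne : pminor A k (Nat.le_of_succ_le hk') ≠ 0 := by
        rcases Nat.eq_zero_or_pos k with rfl | h0
        · simp [pminor]
        · exact hp k h0 (by omega)
      have hdiv : (if k + 1 = 1 then 1 else α (k + 1 - 1) ⟨k + 1 - 2, by omega⟩
          ⟨k + 1 - 2, by omega⟩) = pminor A k (Nat.le_of_succ_le hk') := by
        cases k with
        | zero => simp [pminor]
        | succ k =>
          rw [if_neg (by omega), pminor_succ]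
          exact ih k (by omega) (by omega) _ _ le_rfl le_rfl
      rw [hrec (k + 1) (by omega) (by omega) i j hi hj, hdiv, div_eq_iff hne,
        mul_comm _ (pminor _ _ _), pminor_mul_borderedMinor_succ A hk' hne.isUnit]
      simp only [Nat.add_sub_cancel]
      rw [ih k k.lt_succ_self hk' _ _ le_rfl le_rfl,
        ih k k.lt_succ_self hk' i j (by omega) (by omega),
        ih k k.lt_succ_self hk' i _ (by omega) le_rfl,
        ih k k.lt_succ_self hk' _ j le_rfl (by omega)]
  have main : ∀ k (hk1 : 1 ≤ k) (hk : k ≤ n),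
      α k ⟨k - 1, by omega⟩ ⟨k - 1, by omega⟩ = pminor A k hk := by
    intro k hk1 hk
    obtain ⟨k, rfl⟩ := Nat.exists_eq_add_of_le' hk1
    rw [pminor_succ]
    exact key k hk _ _ le_rfl le_rfl
  exact ⟨main, fun hn => main n hn le_rfl⟩
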